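/- Let O ⊂ SL(2,ℂ) be the binary octahedral group generated by diag(i,−i), [[0,i],[i,0]], (1/2)[[1+i, −1+i],[1+i, 1−i]], and (1/√2)[[1+i, 0],[0, 1−i]], and set F₁ = xy(x⁴−y⁴), F₂ = x⁸ + 14x⁴y⁴ + y⁸, F₃ = x¹² − 33x⁸y⁴ − 33x⁴y⁸ + y¹². A nonzero binary form f ∈ ℂ[x,y] is semi-invariant under every element of O if and only if f is a nonzero scalar multiple of F₁^α F₂^β F₃^γ ∏_{i=1}^N (λ_i F₁⁴ + μ_i F₂³) for some nonnegative integers α, β, γ, N and pairs (λ_i, μ_i) ∈ ℂ² \ {(0,0)}. -/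

import Mathlib

open MvPolynomial Matrix

noncomputable section

/-- Polynomials in two variables `x = X 0`, `y = X 1` over `ℂ`. -/
abbrev BPoly : Type := MvPolynomial (Fin 2) ℂ

/-- The variable `x`. -/
def Px : BPoly := X 0

/-- The variable `y`. -/
def Py : BPoly := X 1

/-- Substitution action of a 2×2 matrix on polynomials in two variables:
for `A = [[p,q],[r,s]]`, `(f·A)(x,y) = f(px+qy, rx+sy)`. -/
def matAct (A : Matrix (Fin 2) (Fin 2) ℂ) (f : BPoly) : BPoly :=
  bind₁ (fun i => C (A i 0) * Px + C (A i 1) * Py) f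

/-- `f` is semi-invariant under `A`: `f·A = c·f` for some nonzero scalar `c`. -/
def SemiInv (A : Matrix (Fin 2) (Fin 2) ℂ) (f : BPoly) : Prop :=
  ∃ c : ℂ, c ≠ 0 ∧ matAct A f = C c * f

/-- The stabilizer of `f` inside `SL(2,ℂ)`: all matrices under which `f` is
semi-invariant. -/
def Stab (f : BPoly) : Set (SpecialLinearGroup (Fin 2) ℂ) :=
  {A | SemiInv (A : Matrix (Fin 2) (Fin 2) ℂ) f}

/-- `f` is a (nonzero) binary form: nonzero and homogeneous of some degree. -/
def IsBinaryForm (f : BPoly) : Prop :=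
  f ≠ 0 ∧ ∃ d : ℕ, f.IsHomogeneous d

/-- `f` is `SL(2,ℂ)`-equivalent to `g` up to a nonzero scalar:
`c·(f·A) = g` for some `A ∈ SL(2,ℂ)` and `c ≠ 0`. -/
def EquivForm (f g : BPoly) : Prop :=
  ∃ A : SpecialLinearGroup (Fin 2) ℂ, ∃ c : ℂ, c ≠ 0 ∧
    C c * matAct (A : Matrix (Fin 2) (Fin 2) ℂ) f = g

/-- Klein's sextic octahedral ground form. -/
abbrev octF1 : BPoly := Px * Py * (Px ^ 4 - Py ^ 4)

/-- Klein's octic octahedral ground form. -/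
abbrev octF2 : BPoly := Px ^ 8 + C 14 * Px ^ 4 * Py ^ 4 + Py ^ 8

/-- Klein's octahedral ground form of degree twelve. -/
abbrev octF3 : BPoly :=
  Px ^ 12 - C 33 * Px ^ 8 * Py ^ 4 - C 33 * Px ^ 4 * Py ^ 8 + Py ^ 12

theorem eval_matAct (A : Matrix (Fin 2) (Fin 2) ℂ) (f : BPoly) (u v : ℂ) :
    eval ![u, v] (matAct A f) =
      eval ![A 0 0 * u + A 0 1 * v, A 1 0 * u + A 1 1 * v] f := by
  have h : (eval ![u, v] : BPoly →+* ℂ).comp (bind₁ fun i => C (A i 0) * Px + C (A i 1) * Py).toRingHom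
      = eval ![A 0 0 * u + A 0 1 * v, A 1 0 * u + A 1 1 * v] := by
    apply MvPolynomial.ringHom_ext
    · intro r; simp
    · intro i; fin_cases i <;> simp [Px, Py]
  exact congrArg (fun g : BPoly →+* ℂ => g f) h

theorem binary_funext {f g : BPoly} (h : ∀ u v : ℂ, eval ![u, v] f = eval ![u, v] g) :
    f = g := by
  apply MvPolynomial.funext
  intro x
  have hx : x = ![x 0, x 1] := by ext i; fin_cases i <;> rfl
  rw [hx]
  exact h _ _

theorem matAct_eq_iff {A : Matrix (Fin 2) (Fin 2) ℂ} {f : BPoly} {c : ℂ} :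
    matAct A f = C c * f ↔ ∀ u v : ℂ,
      eval ![A 0 0 * u + A 0 1 * v, A 1 0 * u + A 1 1 * v] f = c * eval ![u, v] f := by
  constructor
  · intro h u v
    rw [← eval_matAct, h]; simp
  · intro h
    apply binary_funext
    intro u v
    rw [eval_matAct, h]; simp

theorem eval_smul_of_isHomogeneous {f : BPoly} {d : ℕ} (hf : f.IsHomogeneous d) (t u v : ℂ) :
    eval ![t * u, t * v] f = t ^ d * eval ![u, v] f := by
  rw [MvPolynomial.eval_eq', MvPolynomial.eval_eq', Finset.mul_sum]
  refine Finset.sum_congr rfl fun s hs => ?_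
  have := hf (MvPolynomial.mem_support_iff.1 hs)
  rw [Finsupp.weight_apply, Finsupp.sum_fintype _ _ (by simp)] at this
  simp [Fin.prod_univ_two, Fin.sum_univ_two] at this ⊢
  rw [← this]; ring

theorem exists_homogenize_eq {f : BPoly} {d : ℕ} (hf : f.IsHomogeneous d) :
    ∃ p : Polynomial ℂ, p.natDegree ≤ d ∧ p.homogenize d = f := by
  refine ⟨aeval ![Polynomial.X, 1] f, ?_, Polynomial.homogenize_eq_of_isHomogeneous hf rfl⟩
  have := MvPolynomial.aeval_natDegree_le (m := d) (F := f) hf.totalDegree_le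
    ![Polynomial.X, 1] (n := 1) (by intro i; fin_cases i <;> simp)
  simpa using this

theorem eval_homogenize_sum (p : Polynomial ℂ) (d : ℕ) (u v : ℂ) :
    eval ![u, v] (p.homogenize d) =
      ∑ k ∈ Finset.range (d + 1), p.coeff k * (u ^ k * v ^ (d - k)) := by
  rw [Polynomial.homogenize, map_sum, Finset.Nat.sum_antidiagonal_eq_sum_range_succ_mk]
  refine Finset.sum_congr rfl fun k hk => ?_
  rw [eval_monomial, Finsupp.prod_fintype _ _ (by simp)]
  simp [Fin.prod_univ_two]

theorem eval_one_zero_homogenize (p : Polynomial ℂ) (d : ℕ) :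
    eval ![1, 0] (p.homogenize d) = p.coeff d := by
  rw [eval_homogenize_sum, Finset.sum_eq_single d]
  · simp
  · intro k hk hkd
    have : d - k ≠ 0 := by simp at hk; omega
    simp [this]
  · simp

theorem octF1_eq_homogenize :
    (Polynomial.X ^ 5 - Polynomial.X : Polynomial ℂ).homogenize 6 = octF1 := by
  apply binary_funext
  intro u v
  rw [eval_homogenize_sum]
  simp [Finset.sum_range_succ, Polynomial.coeff_X, Polynomial.coeff_X_pow, Px, Py]
  ring

theorem X_pow_five_sub_X_dvd {p : Polynomial ℂ} (h0 : p.eval 0 = 0) (h1 : p.eval 1 = 0)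
    (h2 : p.eval (-1) = 0) (h3 : p.eval Complex.I = 0) (h4 : p.eval (-Complex.I) = 0) :
    (Polynomial.X ^ 5 - Polynomial.X : Polynomial ℂ) ∣ p := by
  have hprod : (Polynomial.X ^ 5 - Polynomial.X : Polynomial ℂ) =
      ∏ a ∈ ({0, 1, -1, Complex.I, -Complex.I} : Finset ℂ), (Polynomial.X - Polynomial.C a) := by
    have hI : Polynomial.C Complex.I ^ 2 = (-1 : Polynomial ℂ) := by
      rw [← Polynomial.C_pow]; simp
    rw [Finset.prod_insert, Finset.prod_insert, Finset.prod_insert, Finset.prod_insert,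
      Finset.prod_singleton]
    · simp only [Polynomial.C_neg, Polynomial.C_0, Polynomial.C_1]
      linear_combination (Polynomial.X ^ 3 - Polynomial.X) * hI
    all_goals norm_num [Complex.ext_iff]
  rw [hprod]
  refine Finset.prod_dvd_of_coprime ?_ ?_
  · intro a _ b _ hab
    exact Polynomial.isCoprime_X_sub_C_of_isUnit_sub (sub_ne_zero.2 hab).isUnit
  · intro a ha
    rw [Polynomial.dvd_iff_isRoot]
    simp only [Finset.mem_insert, Finset.mem_singleton] at ha
    rcases ha with rfl | rfl | rfl | rfl | rfl <;> assumption

theorem octF1_dvd {f : BPoly} {d : ℕ} (hf : f.IsHomogeneous d) (hf0 : f ≠ 0)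
    (hinf : eval ![1, 0] f = 0) (h0 : eval ![0, 1] f = 0) (h1 : eval ![1, 1] f = 0)
    (h2 : eval ![-1, 1] f = 0) (h3 : eval ![Complex.I, 1] f = 0)
    (h4 : eval ![-Complex.I, 1] f = 0) :
    ∃ (e : ℕ) (g : BPoly), d = 6 + e ∧ g.IsHomogeneous e ∧ f = octF1 * g := by
  obtain ⟨p, hpd, rfl⟩ := exists_homogenize_eq hf
  rw [eval_one_zero_homogenize] at hinf
  simp only [Polynomial.eval_homogenize hpd ![_, (1 : ℂ)] one_ne_zero] at h0 h1 h2 h3 h4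
  simp at h0 h1 h2 h3 h4
  obtain ⟨q, rfl⟩ := X_pow_five_sub_X_dvd h0 h1 h2 h3 h4
  have hq : q ≠ 0 := by rintro rfl; simp at hf0
  have h5 : (Polynomial.X ^ 5 - Polynomial.X : Polynomial ℂ).natDegree = 5 := by
    compute_degree!
  have hne : (Polynomial.X ^ 5 - Polynomial.X : Polynomial ℂ) ≠ 0 := by
    intro h; rw [h] at h5; simp at h5
  have hdeg := Polynomial.natDegree_mul hne hq
  have hlt : ((Polynomial.X ^ 5 - Polynomial.X : Polynomial ℂ) * q).natDegree ≠ d := by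
    intro h
    rw [← h] at hinf
    exact mul_ne_zero hne hq (Polynomial.leadingCoeff_eq_zero.1 hinf)
  obtain ⟨e, rfl⟩ : ∃ e, d = 6 + e := ⟨d - 6, by omega⟩
  refine ⟨e, q.homogenize e, rfl, Polynomial.isHomogeneous_homogenize q, ?_⟩
  rw [Polynomial.homogenize_mul _ _ (by omega) (by omega), octF1_eq_homogenize]

/-- The multipliers of a nonzero function on `ℂ²`, homogeneous of degree `d`, that is
semi-invariant under the four generators of the binary octahedral group. -/
theorem octahedral_multipliers {φ : ℂ → ℂ → ℂ} {d : ℕ} {i w w' c₁ c₂ c₃ c₄ : ℂ}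
    (hi : i ^ 2 = -1) (hw : w ^ 2 = i) (hww' : w * w' = 1)
    (hφ : ∀ t u v, φ (t * u) (t * v) = t ^ d * φ u v) {u v : ℂ} (huv : φ u v ≠ 0)
    (hc₁ : c₁ ≠ 0) (hc₂ : c₂ ≠ 0) (hc₃ : c₃ ≠ 0) (hc₄ : c₄ ≠ 0)
    (h₁ : ∀ u v, φ (i * u) (-i * v) = c₁ * φ u v)
    (h₂ : ∀ u v, φ (i * v) (i * u) = c₂ * φ u v)
    (h₃ : ∀ u v, φ ((1 + i) / 2 * u + (-1 + i) / 2 * v) ((1 + i) / 2 * u + (1 - i) / 2 * v)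
      = c₃ * φ u v)
    (h₄ : ∀ u v, φ (w * u) (w' * v) = c₄ * φ u v) :
    Even d ∧ c₂ = 1 ∧ c₃ = 1 ∧ c₄ ^ 2 = 1 := by
  have cancel : ∀ {a b : ℂ}, a * φ u v = b * φ u v → a = b :=
    fun h => mul_right_cancel₀ huv h
  have hd : (-1 : ℂ) ^ d = 1 := by
    have e₁ := h₁ (i * v) (i * u)
    have e₂ := h₂ (i * u) (-i * v)
    rw [h₂] at e₁
    rw [h₁] at e₂
    have e₃ := hφ (-1) (i * (-i * v)) (i * (i * u))
    rw [e₂, show -1 * (i * (-i * v)) = i * (i * v) by ring,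
      show -1 * (i * (i * u)) = -i * (i * u) by ring, e₁] at e₃
    have := @cancel (c₁ * c₂) ((-1) ^ d * (c₂ * c₁)) (by linear_combination e₃)
    have h0 := mul_ne_zero hc₁ hc₂
    field_simp at this
    exact this.symm
  have hc₂' : c₂ = 1 := by
    have e₁ := h₁ ((1 + i) / 2 * u + (-1 + i) / 2 * v) ((1 + i) / 2 * u + (1 - i) / 2 * v)
    have e₂ := h₃ (i * (i * v)) (-i * (i * u))
    rw [h₃] at e₁
    rw [h₁, h₂] at e₂
    have e := congrArg₂ φ
      (show i * ((1 + i) / 2 * u + (-1 + i) / 2 * v) =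
        (1 + i) / 2 * (i * (i * v)) + (-1 + i) / 2 * (-i * (i * u)) by grind)
      (show -i * ((1 + i) / 2 * u + (1 - i) / 2 * v) =
        (1 + i) / 2 * (i * (i * v)) + (1 - i) / 2 * (-i * (i * u)) by grind)
    rw [e₁, e₂] at e
    have := @cancel (c₁ * c₃) (c₃ * c₁ * c₂) (by linear_combination e)
    have h0 := mul_ne_zero hc₃ hc₁
    exact mul_left_cancel₀ h0 (by linear_combination -this)
  have hc₁' : c₁ = 1 := by
    have e₁ := h₂ ((1 + i) / 2 * u + (-1 + i) / 2 * v) ((1 + i) / 2 * u + (1 - i) / 2 * v)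
    have e₂ := h₃ (i * u) (-i * v)
    rw [h₃] at e₁
    rw [h₁] at e₂
    have e := congrArg₂ φ
      (show i * ((1 + i) / 2 * u + (1 - i) / 2 * v) =
        (1 + i) / 2 * (i * u) + (-1 + i) / 2 * (-i * v) by grind)
      (show i * ((1 + i) / 2 * u + (-1 + i) / 2 * v) =
        (1 + i) / 2 * (i * u) + (1 - i) / 2 * (-i * v) by grind)
    rw [e₁, e₂, hc₂'] at e
    have := @cancel c₃ (c₃ * c₁) (by linear_combination e)
    exact mul_left_cancel₀ hc₃ (by linear_combination -this)
  have hc₃' : c₃ ^ 3 = 1 := by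
    set p := (1 + i) / 2 * u + (-1 + i) / 2 * v with hp
    set q := (1 + i) / 2 * u + (1 - i) / 2 * v with hq
    have e := congrArg₂ φ
      (show (1 + i) / 2 * ((1 + i) / 2 * p + (-1 + i) / 2 * q)
          + (-1 + i) / 2 * ((1 + i) / 2 * p + (1 - i) / 2 * q) = -1 * u by grind)
      (show (1 + i) / 2 * ((1 + i) / 2 * p + (-1 + i) / 2 * q)
          + (1 - i) / 2 * ((1 + i) / 2 * p + (1 - i) / 2 * q) = -1 * v by grind)
    rw [hφ, h₃, h₃, hp, hq, h₃, hd] at e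
    exact cancel (by linear_combination e)
  have hc₃'' : c₃ ^ 2 = 1 := by
    set p := (1 + i) / 2 * u + (-1 + i) / 2 * v with hp
    set q := (1 + i) / 2 * u + (1 - i) / 2 * v with hq
    have hw' : w' = -i * w := by grind
    have e := congrArg₂ φ
      (show (1 + i) / 2 * (w * p) + (-1 + i) / 2 * (w' * q) = i * (w * u) by grind)
      (show (1 + i) / 2 * (w * p) + (1 - i) / 2 * (w' * q) = -i * (w' * v) by grind)
    rw [h₃, h₁, h₄, h₄, hp, hq, h₃, hc₁'] at e
    have := @cancel (c₄ * c₃ ^ 2) c₄ (by linear_combination e)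
    exact mul_left_cancel₀ hc₄ (by linear_combination this)
  refine ⟨?_, hc₂', by linear_combination hc₃' - c₃ * hc₃'', ?_⟩
  · by_contra h
    rw [Nat.not_even_iff_odd] at h
    rw [h.neg_one_pow] at hd
    norm_num at hd
  · have e := congrArg₂ φ
      (show w * (w * u) = i * u by grind) (show w' * (w' * v) = -i * v by grind)
    rw [h₄, h₄, h₁, hc₁'] at e
    exact cancel (by linear_combination e)

/-- `f` is fixed by the generators of orders `4` and `6` of the binary octahedral group and
has multiplier `ε` under `diag(w, w')`. -/
def IsOctSemiInv (w w' ε : ℂ) (f : BPoly) : Prop :=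
  matAct !![0, Complex.I; Complex.I, 0] f = f ∧
  matAct !![(1 + Complex.I) / 2, (-1 + Complex.I) / 2;
    (1 + Complex.I) / 2, (1 - Complex.I) / 2] f = f ∧
  matAct !![w, 0; 0, w'] f = C ε * f

theorem matAct_mul (A : Matrix (Fin 2) (Fin 2) ℂ) (f g : BPoly) :
    matAct A (f * g) = matAct A f * matAct A g := map_mul _ f g

theorem matAct_eq_C_mul_of_mul_left {A : Matrix (Fin 2) (Fin 2) ℂ} {f g : BPoly} {a c : ℂ}
    (hf : f ≠ 0) (ha : a ≠ 0) (hA : matAct A f = C a * f)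
    (h : matAct A (f * g) = C c * (f * g)) : matAct A g = C (c / a) * g := by
  rw [matAct_mul, hA] at h
  have hC : (C a : BPoly) ≠ 0 := by simpa using ha
  apply mul_left_cancel₀ (mul_ne_zero hC hf)
  rw [h]
  have : (C c : BPoly) = C a * C (c / a) := by rw [← C_mul]; congr 1; field_simp
  rw [this]; ring

theorem matAct_eq_self_iff {A : Matrix (Fin 2) (Fin 2) ℂ} {f : BPoly} :
    matAct A f = f ↔ matAct A f = C 1 * f := by simp

namespace IsOctSemiInv

variable {w w' ε δ : ℂ} {f g : BPoly}

theorem mul (hf : IsOctSemiInv w w' ε f) (hg : IsOctSemiInv w w' δ g) :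
    IsOctSemiInv w w' (ε * δ) (f * g) := by
  refine ⟨?_, ?_, ?_⟩
  · rw [matAct_mul, hf.1, hg.1]
  · rw [matAct_mul, hf.2.1, hg.2.1]
  · rw [matAct_mul, hf.2.2, hg.2.2, C_mul]; ring

theorem one : IsOctSemiInv w w' 1 1 := by
  simp [IsOctSemiInv, matAct]

theorem pow (hf : IsOctSemiInv w w' ε f) (n : ℕ) : IsOctSemiInv w w' (ε ^ n) (f ^ n) := by
  induction n with
  | zero => simpa using one
  | succ n ih => simpa only [pow_succ] using ih.mul hf

theorem sub_C_mul (hf : IsOctSemiInv w w' ε f) (hg : IsOctSemiInv w w' ε g) (a : ℂ) :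
    IsOctSemiInv w w' ε (f - C a * g) := by
  have key : ∀ A, matAct A (f - C a * g) = matAct A f - C a * matAct A g := by
    intro A; simp [matAct]
  refine ⟨?_, ?_, ?_⟩
  · rw [key, hf.1, hg.1]
  · rw [key, hf.2.1, hg.2.1]
  · rw [key, hf.2.2, hg.2.2]; ring

theorem of_mul_left (hf0 : f ≠ 0) (hε : ε ≠ 0) (hf : IsOctSemiInv w w' ε f)
    (h : IsOctSemiInv w w' δ (f * g)) : IsOctSemiInv w w' (δ / ε) g := by
  refine ⟨?_, ?_, matAct_eq_C_mul_of_mul_left hf0 hε hf.2.2 h.2.2⟩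
  · simpa using matAct_eq_C_mul_of_mul_left hf0 one_ne_zero (matAct_eq_self_iff.1 hf.1)
      (matAct_eq_self_iff.1 h.1)
  · simpa using matAct_eq_C_mul_of_mul_left hf0 one_ne_zero (matAct_eq_self_iff.1 hf.2.1)
      (matAct_eq_self_iff.1 h.2.1)

theorem iff_eval : IsOctSemiInv w w' ε f ↔
    (∀ u v : ℂ, eval ![Complex.I * v, Complex.I * u] f = eval ![u, v] f) ∧
    (∀ u v : ℂ, eval ![(1 + Complex.I) / 2 * u + (-1 + Complex.I) / 2 * v,
      (1 + Complex.I) / 2 * u + (1 - Complex.I) / 2 * v] f = eval ![u, v] f) ∧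
    (∀ u v : ℂ, eval ![w * u, w' * v] f = ε * eval ![u, v] f) := by
  rw [IsOctSemiInv, matAct_eq_self_iff, matAct_eq_self_iff]
  simp only [matAct_eq_iff]
  simp

theorem octF1 (hw : w ^ 2 = Complex.I) (hww' : w * w' = 1) :
    IsOctSemiInv w w' (-1) octF1 := by
  have hI := Complex.I_sq
  have hw' : w' = -Complex.I * w := by grind
  rw [iff_eval]
  simp only [_root_.octF1, Px, Py]
  generalize Complex.I = i at *
  refine ⟨fun u v => ?_, fun u v => ?_, fun u v => ?_⟩ <;> simp <;> grind

theorem octF2 (hw : w ^ 2 = Complex.I) (hww' : w * w' = 1) :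
    IsOctSemiInv w w' 1 octF2 := by
  have hI := Complex.I_sq
  have hw' : w' = -Complex.I * w := by grind
  rw [iff_eval]
  simp only [_root_.octF2, Px, Py]
  generalize Complex.I = i at *
  refine ⟨fun u v => ?_, fun u v => ?_, fun u v => ?_⟩ <;> simp <;> grind

theorem octF3 (hw : w ^ 2 = Complex.I) (hww' : w * w' = 1) :
    IsOctSemiInv w w' (-1) octF3 := by
  have hI := Complex.I_sq
  have hw' : w' = -Complex.I * w := by grind
  rw [iff_eval]
  simp only [_root_.octF3, Px, Py]
  generalize Complex.I = i at *
  refine ⟨fun u v => ?_, fun u v => ?_, fun u v => ?_⟩ <;> simp <;> grind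

end IsOctSemiInv

theorem isHomogeneous_octF1 : octF1.IsHomogeneous 6 := by
  rw [← octF1_eq_homogenize]
  exact Polynomial.isHomogeneous_homogenize _

theorem isHomogeneous_octF2 : octF2.IsHomogeneous 8 := by
  have hx : Px.IsHomogeneous 1 := isHomogeneous_X _ _
  have hy : Py.IsHomogeneous 1 := isHomogeneous_X _ _
  have h := ((hx.pow 4).mul (hy.pow 4)).C_mul 14
  rw [← mul_assoc] at h
  exact ((hx.pow 8).add h).add (hy.pow 8)

theorem isHomogeneous_octF3 : octF3.IsHomogeneous 12 := by
  have hx : Px.IsHomogeneous 1 := isHomogeneous_X _ _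
  have hy : Py.IsHomogeneous 1 := isHomogeneous_X _ _
  have h := ((hx.pow 8).mul (hy.pow 4)).C_mul 33
  have h' := ((hx.pow 4).mul (hy.pow 8)).C_mul 33
  rw [← mul_assoc] at h h'
  exact (((hx.pow 12).sub h).sub h').add (hy.pow 12)

theorem octF1_ne_zero : octF1 ≠ 0 := by
  intro h
  have := congrArg (eval ![2, 1]) h
  norm_num [Px, Py] at this

namespace IsOctSemiInv

variable {w w' ε : ℂ} {f : BPoly} {d m : ℕ}

/-- A semi-invariant vanishing at one vertex of the octahedron is divisible by `octF1`. -/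
theorem octF1_dvd_of_eval_eq_zero (hw : w ^ 2 = Complex.I) (hww' : w * w' = 1)
    (hf : IsOctSemiInv w w' ε f) (hd : f.IsHomogeneous d) (hf0 : f ≠ 0)
    (h : eval ![1, 0] f = 0) :
    ∃ (e : ℕ) (g : BPoly), d = 6 + e ∧ g.IsHomogeneous e ∧ f = _root_.octF1 * g := by
  obtain ⟨h₂, h₃, h₄⟩ := iff_eval.1 hf
  have scale : ∀ {t u v : ℂ}, t ≠ 0 → eval ![t * u, t * v] f = 0 → eval ![u, v] f = 0 := by
    intro t u v ht h
    rw [eval_smul_of_isHomogeneous hd] at h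
    exact (mul_eq_zero.1 h).resolve_left (pow_ne_zero _ ht)
  have hI := Complex.I_sq
  have hI0 := Complex.I_ne_zero
  have h0 : eval ![0, 1] f = 0 := by
    apply scale hI0
    rw [h₂, h]
  have h1 : eval ![1, 1] f = 0 := by
    have hne : (1 + Complex.I) / 2 ≠ 0 := by norm_num [Complex.ext_iff]
    apply scale hne
    simpa [h] using h₃ 1 0
  have rot : ∀ {u : ℂ}, eval ![u, 1] f = 0 → eval ![Complex.I * u, 1] f = 0 := by
    intro u hu
    have hw'0 : w' ≠ 0 := right_ne_zero_of_mul_eq_one hww'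
    apply scale hw'0
    have := h₄ u 1
    rw [hu, mul_zero] at this
    rwa [show w' * (Complex.I * u) = w * u by rw [← hw]; linear_combination w * u * hww']
  have h3 := rot h1
  have h2 := rot h3
  have h4 := rot h2
  rw [mul_one] at h3 h2 h4
  rw [Complex.I_mul_I] at h2 h4
  rw [mul_neg, mul_one] at h4
  exact octF1_dvd hd hf0 h h0 h1 h2 h3 h4

theorem I_pow_eq_of_eval_ne_zero (hw : w ^ 2 = Complex.I)
    (hf : IsOctSemiInv w w' ε f) (hd : f.IsHomogeneous (2 * m)) (h : eval ![1, 0] f ≠ 0) :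
    Complex.I ^ m = ε := by
  have h₄ := (iff_eval.1 hf).2.2 1 0
  have := eval_smul_of_isHomogeneous hd w 1 0
  rw [mul_zero] at h₄ this
  rw [h₄, pow_mul, hw] at this
  exact (mul_right_cancel₀ h this).symm

/-- There is no nonzero quartic semi-invariant with multiplier `-1`. -/
theorem eval_eq_zero_of_quartic (hw : w ^ 2 = Complex.I) (hww' : w * w' = 1)
    (hf : IsOctSemiInv w w' (-1) f) (hd : f.IsHomogeneous 4) : eval ![1, 0] f = 0 := by
  obtain ⟨h₂, h₃, h₄⟩ := iff_eval.1 hf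
  obtain ⟨p, -, rfl⟩ := exists_homogenize_eq hd
  simp only [eval_homogenize_sum, Finset.sum_range_succ, Finset.sum_range_zero] at h₂ h₃ h₄ ⊢
  have hI := Complex.I_sq
  have hw' : w' = -Complex.I * w := by grind
  have e₁ := h₄ 1 1
  have e₂ := h₄ 1 (-1)
  have e₃ := h₂ 1 0
  have e₄ := h₃ 1 0
  have e₅ := h₃ 0 1
  simp at e₁ e₂ e₃ e₄ e₅ ⊢
  generalize Complex.I = i at *
  have a₂ : p.coeff 2 = 0 := by grind
  have a₀ : p.coeff 0 = p.coeff 4 := by grind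
  have b₁ : p.coeff 0 + p.coeff 1 + p.coeff 3 + p.coeff 4 = -4 * p.coeff 4 := by grind
  have b₂ : p.coeff 0 - p.coeff 1 - p.coeff 3 + p.coeff 4 = -4 * p.coeff 4 := by grind
  linear_combination (b₁ + b₂ - 2 * a₀) / 12

end IsOctSemiInv

/-- The span of the monomials `F₁ ^ i * F₂ ^ j * F₃ ^ c` of degree `2 * m` in the octahedral
ground forms. -/
def octSpan (c m : ℕ) : Submodule ℂ BPoly :=
  Submodule.span ℂ
    {g | ∃ i j : ℕ, 3 * i + 4 * j + 6 * c = m ∧ g = octF1 ^ i * octF2 ^ j * octF3 ^ c}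

theorem octF1_mul_mem_octSpan {c m : ℕ} {g : BPoly} (hg : g ∈ octSpan c m) :
    octF1 * g ∈ octSpan c (m + 3) := by
  unfold octSpan at hg
  induction hg using Submodule.span_induction with
  | mem x hx =>
    obtain ⟨i, j, hij, rfl⟩ := hx
    exact Submodule.subset_span ⟨i + 1, j, by omega, by ring⟩
  | zero => simp
  | add x y _ _ hx hy => rw [mul_add]; exact add_mem hx hy
  | smul a x _ hx => rw [mul_smul_comm]; exact Submodule.smul_mem _ a hx

theorem IsOctSemiInv.mem_octSpan {w w' : ℂ} (hw : w ^ 2 = Complex.I) (hww' : w * w' = 1)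
    {c : ℕ} (hc : c ≤ 1) (m e : ℕ) (f : BPoly) (hf : IsOctSemiInv w w' ((-1) ^ e) f)
    (hd : f.IsHomogeneous (2 * m)) (hpar : Even (m + e + c)) : f ∈ octSpan c m := by
  induction m using Nat.strong_induction_on generalizing e f with
  | _ m ih =>
  have vanish : ∀ g : BPoly, IsOctSemiInv w w' ((-1) ^ e) g → g.IsHomogeneous (2 * m) →
      eval ![1, 0] g = 0 → g ∈ octSpan c m := by
    intro g hg hgd h0
    by_cases hg0 : g = 0
    · rw [hg0]; exact zero_mem _
    obtain ⟨k, q, hk, hq, rfl⟩ := hg.octF1_dvd_of_eval_eq_zero hw hww' hgd hg0 h0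
    obtain ⟨n, rfl⟩ : ∃ n, m = n + 3 := ⟨m - 3, by omega⟩
    obtain rfl : k = 2 * n := by omega
    apply octF1_mul_mem_octSpan
    refine ih n (by omega) (e + 1) q ?_ hq ?_
    · have := of_mul_left octF1_ne_zero (by norm_num) (IsOctSemiInv.octF1 hw hww') hg
      rwa [div_neg, div_one, ← mul_neg_one, ← pow_succ] at this
    · grind
  by_cases h0 : eval ![1, 0] f = 0
  · exact vanish f hf hd h0
  have hIm := hf.I_pow_eq_of_eval_ne_zero hw hd h0
  obtain ⟨n, rfl⟩ : Even m := by
    by_contra hm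
    rw [Nat.not_even_iff_odd] at hm
    obtain ⟨n, rfl⟩ := hm
    rw [pow_succ, pow_mul, Complex.I_sq] at hIm
    have := congrArg Complex.re hIm
    rcases neg_one_pow_eq_or ℂ n with h | h <;> rcases neg_one_pow_eq_or ℂ e with h' | h' <;>
      simp [h, h'] at this
  have hne : Even n ↔ Even e := by
    rw [← two_mul, pow_mul, Complex.I_sq] at hIm
    rw [← neg_one_pow_eq_one_iff_even (R := ℂ) (by norm_num), hIm,
      neg_one_pow_eq_one_iff_even (by norm_num)]
  obtain ⟨k, hk⟩ : ∃ k, n = 2 * k + 3 * c := by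
    have hn : Even (n + c) := by
      have := hpar
      simp only [Nat.even_add] at this hne ⊢
      tauto
    rcases Nat.le_one_iff_eq_zero_or_eq_one.1 hc with rfl | rfl
    · exact ⟨n / 2, by grind⟩
    · have : n ≠ 1 := by
        rintro rfl
        have he : Odd e := by
          rw [← Nat.not_even_iff_odd, ← hne]; decide
        rw [he.neg_one_pow] at hf
        exact h0 (hf.eval_eq_zero_of_quartic hw hww' hd)
      exact ⟨(n - 3) / 2, by grind⟩
  subst hk
  set B := _root_.octF2 ^ k * _root_.octF3 ^ c with hB
  have hBd : B.IsHomogeneous (2 * (2 * k + 3 * c + (2 * k + 3 * c))) := by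
    convert (isHomogeneous_octF2.pow k).mul (isHomogeneous_octF3.pow c) using 1
    ring
  have hBε : IsOctSemiInv w w' ((-1) ^ e) B := by
    have := ((IsOctSemiInv.octF2 hw hww').pow k).mul ((IsOctSemiInv.octF3 hw hww').pow c)
    convert this using 1
    rw [one_pow, one_mul]
    have hce : Even c ↔ Even e := by
      rw [← hne]; grind
    rcases Nat.even_or_odd e with he | he
    · rw [he.neg_one_pow, (hce.2 he).neg_one_pow]
    · have : Odd c := by
        rwa [← Nat.not_even_iff_odd, hce, Nat.not_even_iff_odd]
      rw [he.neg_one_pow, this.neg_one_pow]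
  have hB1 : eval ![1, 0] B = 1 := by simp [hB, Px, Py]
  have hBmem : B ∈ octSpan c (2 * k + 3 * c + (2 * k + 3 * c)) :=
    Submodule.subset_span ⟨0, k, by ring, by rw [pow_zero, one_mul]⟩
  have := vanish _ (hf.sub_C_mul hBε (eval ![1, 0] f)) (hd.sub (hBd.C_mul _)) (by simp [hB1])
  rw [← sub_add_cancel f (C (eval ![1, 0] f) * B)]
  refine add_mem this ?_
  rw [MvPolynomial.C_mul']
  exact Submodule.smul_mem _ _ hBmem

/-- A binary form over `ℂ`, evaluated at `(U, V)`, is a product of linear combinations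
of `U` and `V`. -/
theorem aeval_homogenize_eq_prod (U V : BPoly) (N : ℕ) (p : Polynomial ℂ) (hp : p ≠ 0)
    (hN : p.natDegree ≤ N) :
    ∃ c : ℂ, c ≠ 0 ∧ ∃ lam mu : Fin N → ℂ, (∀ i, (lam i, mu i) ≠ (0, 0)) ∧
      aeval ![U, V] (p.homogenize N) = C c * ∏ i, (C (lam i) * U + C (mu i) * V) := by
  induction N generalizing p with
  | zero =>
    obtain ⟨a, rfl⟩ := Polynomial.natDegree_eq_zero.1 (Nat.le_zero.1 hN)
    exact ⟨a, by simpa using hp, Fin.elim0, Fin.elim0, fun i => i.elim0, by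
      simp [MvPolynomial.algebraMap_eq]⟩
  | succ N ih =>
    obtain ⟨l, q, a, b, hab, rfl, hl, hq, hlab⟩ : ∃ (l q : Polynomial ℂ) (a b : ℂ),
        (a, b) ≠ (0, 0) ∧ p = l * q ∧ l.natDegree ≤ 1 ∧ q.natDegree ≤ N ∧
        aeval ![U, V] (l.homogenize 1) = C a * U + C b * V := by
      rcases hN.lt_or_eq with h | h
      · exact ⟨1, p, 0, 1, by simp, by simp, by simp, by omega, by simp⟩
      · obtain ⟨r, hr⟩ := IsAlgClosed.exists_root p (by
          rw [Polynomial.degree_eq_natDegree hp, h]; exact_mod_cast N.succ_ne_zero)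
        obtain ⟨q, rfl⟩ := Polynomial.dvd_iff_isRoot.2 hr
        have hq0 : q ≠ 0 := right_ne_zero_of_mul hp
        rw [Polynomial.natDegree_mul (Polynomial.X_sub_C_ne_zero r) hq0,
          Polynomial.natDegree_X_sub_C] at h
        refine ⟨_, q, 1, -r, by simp, rfl, by simp, by omega, ?_⟩
        simp [MvPolynomial.algebraMap_eq, sub_eq_add_neg]
    obtain ⟨c, hc, lam, mu, hlm, heq⟩ := ih q (right_ne_zero_of_mul hp) hq
    refine ⟨c, hc, Fin.cons a lam, Fin.cons b mu, ?_, ?_⟩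
    · intro i
      refine Fin.cases ?_ (fun j => ?_) i
      · simpa using hab
      · simpa using hlm j
    · have hmul := Polynomial.homogenize_mul l q hl hq
      rw [add_comm 1 N] at hmul
      rw [hmul, map_mul, hlab, heq, Fin.prod_univ_succ]
      simp only [Fin.cons_zero, Fin.cons_succ]
      ring

/-- Elements of `octSpan c m` are obtained from binary forms in `F₁ ^ 4` and `F₂ ^ 3`. -/
theorem exists_homogenize_of_mem_octSpan {c m : ℕ} {g : BPoly} (hg : g ∈ octSpan c m)
    (hg0 : g ≠ 0) :
    ∃ (α β N : ℕ) (p : Polynomial ℂ), p.natDegree ≤ N ∧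
      g = octF1 ^ α * octF2 ^ β * octF3 ^ c *
        aeval ![octF1 ^ 4, octF2 ^ 3] (p.homogenize N) := by
  obtain ⟨i, j, hij⟩ : ∃ i j : ℕ, 3 * i + 4 * j + 6 * c = m := by
    by_contra! h
    simp only [octSpan, h, false_and, exists_false, Set.ofPred_false, Submodule.span_empty,
      Submodule.mem_bot] at hg
    exact hg0 hg
  clear hg0
  refine ⟨i % 4, (j + 3 * (i / 4)) % 3, (j + 3 * (i / 4)) / 3, ?_⟩
  unfold octSpan at hg
  induction hg using Submodule.span_induction with
  | mem x hx =>
    obtain ⟨k, l, hkl, rfl⟩ := hx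
    have hk : k / 4 ≤ (j + 3 * (i / 4)) / 3 := by omega
    refine ⟨Polynomial.X ^ (k / 4), by simpa using hk, ?_⟩
    rw [Polynomial.homogenize_X_pow hk]
    simp only [map_mul, map_pow, aeval_X, Matrix.cons_val_zero, Matrix.cons_val_one]
    obtain ⟨s, hs⟩ : ∃ s, s = (j + 3 * (i / 4)) / 3 - k / 4 := ⟨_, rfl⟩
    have hk' : k = i % 4 + 4 * (k / 4) := by omega
    have hl' : l = (j + 3 * (i / 4)) % 3 + 3 * s := by omega
    rw [← hs]
    conv_lhs => rw [hk', hl']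
    rw [pow_add, pow_add, pow_mul, pow_mul]
    ring
  | zero => exact ⟨0, by simp, by simp⟩
  | add x y _ _ hx hy =>
    obtain ⟨p, hp, rfl⟩ := hx
    obtain ⟨q, hq, rfl⟩ := hy
    refine ⟨p + q, Polynomial.natDegree_add_le_of_degree_le hp hq, ?_⟩
    rw [Polynomial.homogenize_add, map_add, mul_add]
  | smul a x _ hx =>
    obtain ⟨p, hp, rfl⟩ := hx
    refine ⟨a • p, (Polynomial.natDegree_smul_le a p).trans hp, ?_⟩
    rw [Polynomial.homogenize_smul, map_smul, mul_smul_comm]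

theorem SemiInv.mul {A : Matrix (Fin 2) (Fin 2) ℂ} {f g : BPoly}
    (hf : SemiInv A f) (hg : SemiInv A g) : SemiInv A (f * g) := by
  obtain ⟨a, ha, hfa⟩ := hf
  obtain ⟨b, hb, hgb⟩ := hg
  refine ⟨a * b, mul_ne_zero ha hb, ?_⟩
  rw [matAct_mul, hfa, hgb, C_mul]
  ring

theorem semiInv_C (A : Matrix (Fin 2) (Fin 2) ℂ) (a : ℂ) : SemiInv A (C a) :=
  ⟨1, one_ne_zero, by simp [matAct]⟩

theorem SemiInv.pow {A : Matrix (Fin 2) (Fin 2) ℂ} {f : BPoly} (hf : SemiInv A f) (n : ℕ) :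
    SemiInv A (f ^ n) := by
  induction n with
  | zero => simpa using semiInv_C A 1
  | succ n ih => simpa only [pow_succ] using ih.mul hf

theorem SemiInv.prod {A : Matrix (Fin 2) (Fin 2) ℂ} {ι : Type*} (s : Finset ι)
    {f : ι → BPoly} (hf : ∀ i ∈ s, SemiInv A (f i)) : SemiInv A (∏ i ∈ s, f i) :=
  Finset.prod_induction _ _ (fun _ _ => SemiInv.mul) (by simpa using semiInv_C A 1) hf

theorem matAct_matAct (A B : Matrix (Fin 2) (Fin 2) ℂ) (f : BPoly) :
    matAct A (matAct B f) = matAct (B * A) f := by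
  apply binary_funext
  intro u v
  simp only [eval_matAct, Matrix.mul_apply, Fin.sum_univ_two]
  congr 2
  ext i
  fin_cases i <;> simp <;> ring

theorem matAct_one (f : BPoly) : matAct 1 f = f := by
  apply binary_funext
  intro u v
  simp [eval_matAct]

theorem semiInv_of_mem_closure {S : Set (SpecialLinearGroup (Fin 2) ℂ)} {f : BPoly}
    (hS : ∀ A ∈ S, SemiInv (A : Matrix (Fin 2) (Fin 2) ℂ) f)
    {A : SpecialLinearGroup (Fin 2) ℂ} (hA : A ∈ Subgroup.closure S) :
    SemiInv (A : Matrix (Fin 2) (Fin 2) ℂ) f := by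
  have hsmul : ∀ (B : Matrix (Fin 2) (Fin 2) ℂ) (c : ℂ),
      matAct B (C c * f) = C c * matAct B f := by
    intro B c; simp [matAct]
  induction hA using Subgroup.closure_induction with
  | mem x hx => exact hS x hx
  | one => exact ⟨1, one_ne_zero, by simp [matAct_one]⟩
  | mul x y _ _ hx hy =>
    obtain ⟨a, ha, hxa⟩ := hx
    obtain ⟨b, hb, hyb⟩ := hy
    refine ⟨a * b, mul_ne_zero ha hb, ?_⟩
    change matAct (x.1 * y.1) f = _
    rw [← matAct_matAct, hxa, hsmul, hyb, C_mul, mul_assoc]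
  | inv x _ hx =>
    obtain ⟨a, ha, hxa⟩ := hx
    refine ⟨a⁻¹, inv_ne_zero ha, ?_⟩
    have h := congrArg (matAct (x⁻¹).1) hxa
    have hx1 : x.1 * (x⁻¹).1 = 1 := congrArg Subtype.val (mul_inv_cancel x)
    rw [matAct_matAct, hx1, matAct_one, hsmul] at h
    rw [← mul_right_inj' (show (C a : BPoly) ≠ 0 by simpa using ha), ← h, ← mul_assoc, ← C_mul,
      mul_inv_cancel₀ ha, C_1, one_mul]

/-- Klein's octahedral products are semi-invariant under any matrix for which `F₁`, `F₂`, `F₃`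
are, provided the multiplier of `F₁ ^ 4` agrees with that of `F₂ ^ 3`. -/
theorem semiInv_octahedral_product {A : Matrix (Fin 2) (Fin 2) ℂ} {a b c : ℂ}
    (h₁ : matAct A octF1 = C a * octF1) (h₂ : matAct A octF2 = C b * octF2)
    (h₃ : matAct A octF3 = C c * octF3) (ha : a ^ 4 = 1) (hb : b = 1) (hc : c ≠ 0)
    (k : ℂ) (α β γ N : ℕ) (lam mu : Fin N → ℂ) :
    SemiInv A (C k * (octF1 ^ α * octF2 ^ β * octF3 ^ γ *
      ∏ i : Fin N, (C (lam i) * octF1 ^ 4 + C (mu i) * octF2 ^ 3))) := by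
  have ha0 : a ≠ 0 := by rintro rfl; norm_num at ha
  refine (semiInv_C A k).mul ((((SemiInv.pow ⟨a, ha0, h₁⟩ α).mul
    (SemiInv.pow ⟨b, by simp [hb], h₂⟩ β)).mul (SemiInv.pow ⟨c, hc, h₃⟩ γ)).mul
    (SemiInv.prod _ fun i _ => ⟨1, one_ne_zero, ?_⟩))
  have key : matAct A (C (lam i) * octF1 ^ 4 + C (mu i) * octF2 ^ 3) =
      C (lam i) * matAct A octF1 ^ 4 + C (mu i) * matAct A octF2 ^ 3 := by
    simp only [matAct, map_add, map_mul, map_pow, bind₁_C_right]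
  rw [key, h₁, h₂, mul_pow, ← C_pow, ha, hb]
  simp

/-- Klein's classification of semi-invariants of the binary octahedral group `O`,
generated by `diag(i,-i)`, `[[0,i],[i,0]]`, `(1/2)[[1+i,-1+i],[1+i,1-i]]` and
`(1/√2)[[1+i,0],[0,1-i]]`: a nonzero binary form is semi-invariant under every
element of `O` iff it is a nonzero scalar multiple of
`F₁^α F₂^β F₃^γ ∏ᵢ (λᵢ F₁⁴ + μᵢ F₂³)`, where `F₁ = xy(x⁴-y⁴)`,
`F₂ = x⁸+14x⁴y⁴+y⁸`, `F₃ = x¹²-33x⁸y⁴-33x⁴y⁸+y¹²` are the ground forms. -/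
theorem semiInv_octahedral_iff
    (s2 : ℂ) (hs2 : s2 ^ 2 = 2)
    (M₁ M₂ M₃ M₄ : SpecialLinearGroup (Fin 2) ℂ)
    (hM₁ : (M₁ : Matrix (Fin 2) (Fin 2) ℂ) = !![Complex.I, 0; 0, -Complex.I])
    (hM₂ : (M₂ : Matrix (Fin 2) (Fin 2) ℂ) = !![0, Complex.I; Complex.I, 0])
    (hM₃ : (M₃ : Matrix (Fin 2) (Fin 2) ℂ) =
      !![(1 + Complex.I) / 2, (-1 + Complex.I) / 2;
         (1 + Complex.I) / 2, (1 - Complex.I) / 2])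
    (hM₄ : (M₄ : Matrix (Fin 2) (Fin 2) ℂ) =
      !![(1 + Complex.I) / s2, 0; 0, (1 - Complex.I) / s2])
    (f : BPoly) (hbf : IsBinaryForm f) :
    (∀ A : SpecialLinearGroup (Fin 2) ℂ, A ∈ Subgroup.closure {M₁, M₂, M₃, M₄} →
        SemiInv (A : Matrix (Fin 2) (Fin 2) ℂ) f) ↔
      ∃ c : ℂ, c ≠ 0 ∧ ∃ (α β γ N : ℕ) (lam mu : Fin N → ℂ),
        (∀ i, (lam i, mu i) ≠ (0, 0)) ∧
        f = C c * ((Px * Py * (Px ^ 4 - Py ^ 4)) ^ α *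
          (Px ^ 8 + C 14 * Px ^ 4 * Py ^ 4 + Py ^ 8) ^ β *
          (Px ^ 12 - C 33 * Px ^ 8 * Py ^ 4 - C 33 * Px ^ 4 * Py ^ 8 + Py ^ 12) ^ γ *
          ∏ i : Fin N,
            (C (lam i) * (Px * Py * (Px ^ 4 - Py ^ 4)) ^ 4 +
             C (mu i) * (Px ^ 8 + C 14 * Px ^ 4 * Py ^ 4 + Py ^ 8) ^ 3)) := by
  set w : ℂ := (1 + Complex.I) / s2 with hwdef
  set w' : ℂ := (1 - Complex.I) / s2 with hwdef'
  have hI := Complex.I_sq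
  have hs0 : s2 ≠ 0 := by rintro rfl; norm_num at hs2
  have hw : w ^ 2 = Complex.I := by
    rw [hwdef, div_pow, hs2]; linear_combination hI / 2
  have hww' : w * w' = 1 := by
    rw [hwdef, hwdef', div_mul_div_comm, ← sq, hs2]; linear_combination -hI / 2
  have hM₁₄ : M₁ = M₄ * M₄ := by
    have hw_sq' : w' * w' = -Complex.I := by grind
    apply Subtype.ext
    change M₁.1 = M₄.1 * M₄.1
    rw [hM₁, hM₄]
    ext i j
    fin_cases i <;> fin_cases j <;> (simp [← hw, hw_sq']; try ring)
  obtain ⟨hf0, d, hd⟩ := hbf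
  constructor
  · intro h
    obtain ⟨c₁, hc₁, h₁⟩ := h M₁ (Subgroup.subset_closure (by simp))
    obtain ⟨c₂, hc₂, h₂⟩ := h M₂ (Subgroup.subset_closure (by simp))
    obtain ⟨c₃, hc₃, h₃⟩ := h M₃ (Subgroup.subset_closure (by simp))
    obtain ⟨c₄, hc₄, h₄⟩ := h M₄ (Subgroup.subset_closure (by simp))
    rw [hM₁] at h₁
    rw [hM₂] at h₂
    rw [hM₃] at h₃
    rw [hM₄] at h₄
    obtain ⟨u, v, huv⟩ : ∃ u v : ℂ, eval ![u, v] f ≠ 0 := by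
      by_contra! hz
      exact hf0 (binary_funext fun u v => by rw [hz, map_zero])
    obtain ⟨⟨m, rfl⟩, rfl, rfl, hc₄'⟩ := octahedral_multipliers
      (φ := fun u v => eval ![u, v] f) hI hw hww' (eval_smul_of_isHomogeneous hd) huv
      hc₁ hc₂ hc₃ hc₄ (by simpa using matAct_eq_iff.1 h₁) (by simpa using matAct_eq_iff.1 h₂)
      (by simpa using matAct_eq_iff.1 h₃) (by simpa using matAct_eq_iff.1 h₄)
    rw [← two_mul] at hd
    obtain ⟨e, rfl⟩ : ∃ e : ℕ, c₄ = (-1) ^ e := by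
      rcases sq_eq_sq_iff_eq_or_eq_neg.1 (hc₄'.trans (one_pow 2).symm) with h | h
      · exact ⟨0, by simpa using h⟩
      · exact ⟨1, by simpa using h⟩
    have hf : IsOctSemiInv w w' ((-1) ^ e) f := ⟨by simpa using h₂, by simpa using h₃, h₄⟩
    have hmem := hf.mem_octSpan hw hww' (c := (m + e) % 2) (by omega) m e f hd (by grind)
    obtain ⟨α, β, N, p, hpN, hfp⟩ := exists_homogenize_of_mem_octSpan hmem hf0
    have hp : p ≠ 0 := by
      rintro rfl
      simp at hfp
      exact hf0 hfp
    obtain ⟨c, hc, lam, mu, hlm, hprod⟩ :=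
      aeval_homogenize_eq_prod (octF1 ^ 4) (octF2 ^ 3) N p hp hpN
    refine ⟨c, hc, α, β, (m + e) % 2, N, lam, mu, hlm, ?_⟩
    rw [hfp, hprod]
    ring
  · rintro ⟨c, -, α, β, γ, N, lam, mu, -, rfl⟩ A hA
    have h₁ := IsOctSemiInv.octF1 hw hww'
    have h₂ := IsOctSemiInv.octF2 hw hww'
    have h₃ := IsOctSemiInv.octF3 hw hww'
    rw [hM₁₄] at hA
    have hle : Subgroup.closure {M₄ * M₄, M₂, M₃, M₄} ≤ Subgroup.closure {M₂, M₃, M₄} := by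
      rw [Subgroup.closure_le]
      have hM₄' : M₄ ∈ Subgroup.closure {M₂, M₃, M₄} := Subgroup.subset_closure (by simp)
      exact Set.insert_subset (mul_mem hM₄' hM₄') Subgroup.subset_closure
    refine semiInv_of_mem_closure ?_ (hle hA)
    rintro B (rfl | rfl | rfl)
    · rw [hM₂]
      exact semiInv_octahedral_product (a := 1) (b := 1) (c := 1) (by simpa using h₁.1)
        (by simpa using h₂.1) (by simpa using h₃.1) (by simp) rfl one_ne_zero _ _ _ _ _ _ _
    · rw [hM₃]
      exact semiInv_octahedral_product (a := 1) (b := 1) (c := 1) (by simpa using h₁.2.1)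
        (by simpa using h₂.2.1) (by simpa using h₃.2.1) (by simp) rfl one_ne_zero _ _ _ _ _ _ _
    · rw [hM₄]
      exact semiInv_octahedral_product h₁.2.2 h₂.2.2 h₃.2.2 (by norm_num) rfl (by norm_num)
        _ _ _ _ _ _ _

end
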